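/- Let K be an m × n complex matrix, δ > 0, and E > 0. Suppose the true solution f_t ∈ ℂⁿ satisfies the source condition f_t = K† v for some v ∈ ℂᵐ with ‖v‖ ≤ E, let g = K f_t, and let g^δ ∈ ℂᵐ satisfy ‖g − g^δ‖ ≤ δ. Then with the a-priori parameter choice α = δ/E, the Tikhonov regularized solution f_α^δ = (K† K + α I)⁻¹ K† g^δ satisfies ‖f_α^δ − f_t‖ ≤ √(δ E). In particular, as δ → 0 the regularized solution converges to the true solution. -/

import Mathlib

open Matrix

/-- The Euclidean norm of a complex vector, written out explicitly. -/
noncomputable def euclNorm {k : ℕ} (v : Fin k → ℂ) : ℝ :=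
  Real.sqrt (∑ i, ‖v i‖ ^ 2)

lemma euclNorm_eq {k : ℕ} (v : Fin k → ℂ) : euclNorm v = ‖WithLp.toLp 2 v‖ := by
  simp [euclNorm, EuclideanSpace.norm_eq]

lemma euclNorm_sq {k : ℕ} (v : Fin k → ℂ) : euclNorm v ^ 2 = ∑ i, ‖v i‖ ^ 2 := by
  rw [euclNorm, Real.sq_sqrt (Finset.sum_nonneg fun i _ => by positivity)]

lemma star_dot_self_re {k : ℕ} (v : Fin k → ℂ) : (star v ⬝ᵥ v).re = euclNorm v ^ 2 := by
  rw [euclNorm_sq, dotProduct, Complex.re_sum]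
  refine Finset.sum_congr rfl fun i _ => ?_
  rw [← Complex.normSq_eq_norm_sq, Complex.normSq_apply]
  simp

lemma star_dot_re_le {k : ℕ} (x w : Fin k → ℂ) :
    (star x ⬝ᵥ w).re ≤ euclNorm x ^ 2 + euclNorm w ^ 2 / 4 := by
  rw [euclNorm_sq, euclNorm_sq, dotProduct, Complex.re_sum, Finset.sum_div,
    ← Finset.sum_add_distrib]
  refine Finset.sum_le_sum fun i _ => ?_
  have h : (star x i * w i).re ≤ ‖x i‖ * ‖w i‖ := by
    refine (Complex.re_le_norm _).trans ?_
    simp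
  nlinarith [sq_nonneg (‖x i‖ - ‖w i‖ / 2)]

open ComplexOrder in
lemma tikhonov_isUnit {m n : ℕ} (K : Matrix (Fin m) (Fin n) ℂ) (a : ℝ) (ha : 0 < a) :
    IsUnit (Kᴴ * K + (a : ℂ) • (1 : Matrix (Fin n) (Fin n) ℂ)) := by
  have h1 : ((a : ℂ) • (1 : Matrix (Fin n) (Fin n) ℂ)).PosDef :=
    Matrix.PosDef.one.smul (by exact_mod_cast ha)
  exact (h1.posSemidef_add (Matrix.posSemidef_conjTranspose_mul_self K)).isUnit

/-- **Convergence of Tikhonov regularization with the a-priori choice `α = δ/E`.**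
If the true solution satisfies `f_t = K† v` with `‖v‖ ≤ E`, `g = K f_t`, and the
noisy data satisfies `‖g − g^δ‖ ≤ δ`, then with `α = δ/E` the Tikhonov
regularized solution satisfies `‖f_α^δ − f_t‖ ≤ √(δ E)`, so it converges to the
true solution as `δ → 0`. -/
theorem tikhonov_a_priori_choice
    (m n : ℕ) (K : Matrix (Fin m) (Fin n) ℂ)
    (δ E : ℝ) (hδ : 0 < δ) (hE : 0 < E)
    (ft : Fin n → ℂ) (v : Fin m → ℂ)
    (hsource : ft = Kᴴ.mulVec v) (hv : euclNorm v ≤ E)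
    (gδ : Fin m → ℂ) (hnoise : euclNorm (K.mulVec ft - gδ) ≤ δ) :
    euclNorm ((Kᴴ * K + ((δ / E : ℝ) : ℂ) • (1 : Matrix (Fin n) (Fin n) ℂ))⁻¹.mulVec
        (Kᴴ.mulVec gδ) - ft) ≤ Real.sqrt (δ * E) := by
  have ha : 0 < δ / E := div_pos hδ hE
  have haE : δ / E * E = δ := div_mul_cancel₀ _ hE.ne'
  set a : ℝ := δ / E with ha_def
  have hU := tikhonov_isUnit K a ha
  set M := Kᴴ * K + (a : ℂ) • (1 : Matrix (Fin n) (Fin n) ℂ) with hM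
  set e := M⁻¹.mulVec (Kᴴ.mulVec gδ) - ft with he
  set w : Fin m → ℂ := -(K.mulVec ft - gδ) - (a : ℂ) • v with hw
  have hMe : M.mulVec e = Kᴴ.mulVec w := by
    rw [he, Matrix.mulVec_sub, Matrix.mulVec_mulVec, Matrix.mul_nonsing_inv _
      ((Matrix.isUnit_iff_isUnit_det _).mp hU), Matrix.one_mulVec, hw, hM,
      Matrix.add_mulVec, Matrix.smul_mulVec, Matrix.one_mulVec, Matrix.mulVec_sub,
      Matrix.mulVec_neg, Matrix.mulVec_sub, Matrix.mulVec_smul, ← hsource,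
      ← Matrix.mulVec_mulVec]
    abel
  have hadj : ∀ y : Fin m → ℂ, star e ⬝ᵥ Kᴴ.mulVec y = star (K.mulVec e) ⬝ᵥ y := by
    intro y
    rw [Matrix.dotProduct_mulVec, Matrix.star_mulVec]
  have hkey : euclNorm (K.mulVec e) ^ 2 + a * euclNorm e ^ 2
      = (star (K.mulVec e) ⬝ᵥ w).re := by
    rw [← hadj, ← hMe, hM, Matrix.add_mulVec, Matrix.smul_mulVec, Matrix.one_mulVec,
      ← Matrix.mulVec_mulVec, dotProduct_add, hadj, dotProduct_smul, smul_eq_mul,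
      Complex.add_re, Complex.re_ofReal_mul, star_dot_self_re, star_dot_self_re]
  have hwn : euclNorm w ≤ 2 * δ := by
    have h : euclNorm w ≤ euclNorm (K.mulVec ft - gδ) + a * euclNorm v := by
      have h2 := norm_sub_le (-(WithLp.toLp 2 (K.mulVec ft - gδ))) ((a : ℂ) • WithLp.toLp 2 v)
      rw [norm_neg, norm_smul, Complex.norm_real, Real.norm_of_nonneg ha.le] at h2
      rw [euclNorm_eq, euclNorm_eq, euclNorm_eq]
      exact h2
    have := mul_le_mul_of_nonneg_left hv ha.le
    linarith
  have hw0 : 0 ≤ euclNorm w := Real.sqrt_nonneg _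
  have hle := star_dot_re_le (K.mulVec e) w
  have h3 : a * euclNorm e ^ 2 ≤ δ ^ 2 := by nlinarith
  refine Real.le_sqrt_of_sq_le ?_
  have h4 : a * euclNorm e ^ 2 ≤ a * (δ * E) := by
    calc _ ≤ δ ^ 2 := h3
      _ = (a * E) * δ := by rw [haE]; ring
      _ = _ := by ring
  exact le_of_mul_le_mul_left h4 ha
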